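/- arXiv:math/0403450 — 5 statements merged into one kernel-verified Lean document; each statement's English description precedes it below -/
import Mathlib

section
/- For every ε > 0 there exists N such that every nontrivial strongly regular graph with parameters (n, k, λ, μ) and n ≥ N satisfies |λ − k²/n| < εn and |μ − k²/n| < εn. -/
open SimpleGraph

/-- A strongly regular graph is nontrivial if both it and its complement contain
three vertices `u, v, w` with `u` adjacent to `v`, `v` adjacent to `w`,
and `u` not adjacent to `w`. -/
def NontrivialSRG {V : Type*} (G : SimpleGraph V) : Prop :=
  (∃ u v w : V, G.Adj u v ∧ G.Adj v w ∧ u ≠ w ∧ ¬G.Adj u w) ∧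
  (∃ u v w : V, Gᶜ.Adj u v ∧ Gᶜ.Adj v w ∧ u ≠ w ∧ ¬Gᶜ.Adj u w)

/-- A matrix with pairwise distinct rows and entries in a finite set `S` has at most
`#S ^ rank` rows. -/
theorem Matrix.card_le_card_pow_rank {m n K : Type*} [Fintype m] [Fintype n] [Field K]
    (M : Matrix m n K) (hM : Function.Injective M.row) (S : Finset K) (hS : ∀ i j, M i j ∈ S) :
    Fintype.card m ≤ S.card ^ M.rank := by
  obtain ⟨f, hf, hspan, -⟩ :=
    Submodule.exists_fun_fin_finrank_span_eq K (Set.range M.col)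
  choose c hc using hf
  have hinj : Function.Injective
      (fun i t ↦ (⟨M i (c t), hS i (c t)⟩ : S) :
        m → Fin (Module.finrank K (Submodule.span K (Set.range M.col))) → S) := by
    intro v w hvw
    have hle : Submodule.span K (Set.range M.col) ≤
        LinearMap.ker (LinearMap.proj (R := K) (φ := fun _ : m ↦ K) v - LinearMap.proj w) := by
      rw [← hspan, Submodule.span_le]
      rintro _ ⟨t, rfl⟩
      have ht : M v (c t) = M w (c t) := congrArg Subtype.val (congrFun hvw t)
      simp [← hc t, ht]
    refine hM (funext fun j ↦ ?_)
    have hj := hle (Submodule.subset_span ⟨j, rfl⟩)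
    simpa [sub_eq_zero] using hj
  have hcard := Fintype.card_le_of_injective _ hinj
  simpa [Matrix.rank_eq_finrank_span_cols] using hcard

/-- The trace of an idempotent matrix is its rank. -/
theorem Matrix.trace_eq_rank_of_isIdempotentElem {n K : Type*} [Fintype n] [DecidableEq n]
    [Field K] {M : Matrix n n K} (hM : IsIdempotentElem M) : M.trace = M.rank := by
  have h : IsIdempotentElem (Matrix.toLin' M) := hM.map Matrix.toLinAlgEquiv'
  have ht := (LinearMap.IsIdempotentElem.isProj_range _ h).trace
  rwa [Matrix.trace_toLin'_eq] at ht

namespace SimpleGraph.IsSRGWith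

variable {V : Type*} [Fintype V] {G : SimpleGraph V} [DecidableRel G.Adj]
  {n k l m : ℕ}

/-- The adjacency matrix of a strongly regular graph satisfies
`A ^ 2 = (k - m) I + (l - m) A + m J`. -/
theorem adjMatrix_mul_self [DecidableEq V] (h : G.IsSRGWith n k l m) :
    G.adjMatrix ℝ * G.adjMatrix ℝ = ((k : ℝ) - m) • (1 : Matrix V V ℝ) +
      ((l : ℝ) - m) • G.adjMatrix ℝ + (m : ℝ) • Matrix.of fun _ _ ↦ (1 : ℝ) := by
  rw [← pow_two, h.matrix_eq]
  ext v w
  simp only [Matrix.add_apply, Matrix.smul_apply, adjMatrix_apply, Matrix.of_apply, compl_adj]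
  obtain rfl | hn := eq_or_ne v w
  · simp
  · by_cases ha : G.Adj v w <;> simp [hn, ha]

theorem adjMatrix_mul_ones (h : G.IsSRGWith n k l m) :
    G.adjMatrix ℝ * (Matrix.of fun _ _ ↦ (1 : ℝ)) = (k : ℝ) • Matrix.of fun _ _ ↦ (1 : ℝ) := by
  ext v w
  simp [adjMatrix_mul_apply, h.regular.degree_eq v]

theorem ones_mul_adjMatrix (h : G.IsSRGWith n k l m) :
    (Matrix.of fun _ _ ↦ (1 : ℝ)) * G.adjMatrix ℝ = (k : ℝ) • Matrix.of fun _ _ ↦ (1 : ℝ) := by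
  ext v w
  simp [mul_adjMatrix_apply, h.regular.degree_eq w]

theorem ones_mul_ones (h : G.IsSRGWith n k l m) :
    (Matrix.of fun (_ _ : V) ↦ (1 : ℝ)) * (Matrix.of fun _ _ ↦ (1 : ℝ)) =
      (n : ℝ) • Matrix.of fun _ _ ↦ (1 : ℝ) := by
  ext v w
  simp [Matrix.mul_apply, h.card]

/-- Counting paths of length two from a vertex of a strongly regular graph. -/
theorem degree_sq_eq [DecidableEq V] [Nonempty V] (h : G.IsSRGWith n k l m) :
    (k : ℝ) ^ 2 = (k - m) + (l - m) * k + m * n := by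
  have key := congrArg (· * (Matrix.of fun (_ _ : V) ↦ (1 : ℝ))) h.adjMatrix_mul_self
  simp only [Matrix.mul_assoc, add_mul, Matrix.smul_mul, Matrix.one_mul, h.adjMatrix_mul_ones,
    h.ones_mul_ones, Matrix.mul_smul] at key
  obtain ⟨v⟩ := ‹Nonempty V›
  have := congrFun (congrFun key v) v
  simp at this
  linarith

/-- A nontrivial strongly regular graph satisfies `m < k` and `l + 1 < k`. -/
theorem param_lt_of_nontrivial [DecidableEq V] (h : G.IsSRGWith n k l m) (hG : NontrivialSRG G) :
    m < k ∧ l + 1 < k := by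
  obtain ⟨⟨u, v, w, huv, hvw, huw, hnuw⟩, ⟨x, y, z, hxy, hyz, hxz, hnxz⟩⟩ := hG
  constructor
  · rw [compl_adj] at hxy hyz
    have hadj : G.Adj x z := by
      by_contra hna
      exact hnxz ((compl_adj ..).2 ⟨hxz, hna⟩)
    rw [← h.of_not_adj hxy.1 hxy.2, ← h.regular.degree_eq x, ← card_neighborFinset_eq_degree,
      ← Set.toFinset_card]
    refine Finset.card_lt_card (Finset.ssubset_iff_subset_ne.2 ⟨fun t ht ↦ ?_, fun he ↦ ?_⟩)
    · simp only [Set.mem_toFinset, mem_commonNeighbors] at ht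
      simpa using ht.1
    · have : z ∈ (G.commonNeighbors x y).toFinset := by rw [he]; simpa using hadj
      simp only [Set.mem_toFinset, mem_commonNeighbors] at this
      exact hyz.2 this.2
  · rw [← h.of_adj u v huv, ← h.regular.degree_eq v, ← card_neighborFinset_eq_degree,
      ← Set.toFinset_card]
    have hu : u ∉ (G.commonNeighbors u v).toFinset := by simp [mem_commonNeighbors]
    rw [← Finset.card_insert_of_notMem hu]
    refine Finset.card_lt_card (Finset.ssubset_iff_subset_ne.2 ⟨fun t ht ↦ ?_, fun he ↦ ?_⟩)
    · simp only [Finset.mem_insert, Set.mem_toFinset, mem_commonNeighbors] at ht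
      rcases ht with rfl | ht
      · simpa using huv.symm
      · simpa using ht.2
    · have : w ∈ insert u (G.commonNeighbors u v).toFinset := by rw [he]; simpa using hvw
      simp only [Finset.mem_insert, Set.mem_toFinset, mem_commonNeighbors] at this
      rcases this with rfl | ht
      · exact huw rfl
      · exact hnuw ht.1

/-- If `θ ≠ τ` are the restricted eigenvalues of a strongly regular graph and `τ ∉ {0, -1}`, then
the multiplicity `r` of `θ` satisfies `n ≤ 3 ^ r`. -/
theorem exists_multiplicity [DecidableEq V] [Nonempty V] (h : G.IsSRGWith n k l m) {θ τ : ℝ}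
    (hadd : θ + τ = l - m) (hmul : θ * τ = m - k) (hne : θ ≠ τ) (h0 : τ ≠ 0) (h1 : τ ≠ -1) :
    ∃ r : ℕ, (r : ℝ) * (θ - τ) = -(n * τ) - (k - τ) ∧ n ≤ 3 ^ r := by
  have hn : (n : ℝ) ≠ 0 := by
    rw [← h.card]
    exact_mod_cast Fintype.card_ne_zero
  have hd : θ - τ ≠ 0 := sub_ne_zero.2 hne
  set A : Matrix V V ℝ := G.adjMatrix ℝ with hA
  set J : Matrix V V ℝ := Matrix.of fun _ _ ↦ (1 : ℝ) with hJ
  set c : ℝ := (k - τ) / n with hc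
  have hcn : c * n = k - τ := div_mul_cancel₀ _ hn
  have hmc : (m : ℝ) = c * (k - θ) := by
    rw [hc, div_mul_eq_mul_div, eq_div_iff hn]
    linear_combination -h.degree_sq_eq + k * hadd - hmul
  set B : Matrix V V ℝ := A - τ • 1 - c • J with hB
  have hBB : B * B = (θ - τ) • B := by
    have e1 : A * A = ((k : ℝ) - m) • (1 : Matrix V V ℝ) + ((l : ℝ) - m) • A + (m : ℝ) • J :=
      h.adjMatrix_mul_self
    have e2 : A * J = (k : ℝ) • J := h.adjMatrix_mul_ones
    have e3 : J * A = (k : ℝ) • J := h.ones_mul_adjMatrix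
    have e4 : J * J = (n : ℝ) • J := h.ones_mul_ones
    simp only [hB, sub_mul, mul_sub, Matrix.smul_mul, Matrix.mul_smul, Matrix.one_mul,
      Matrix.mul_one, e1, e2, e3, e4]
    rw [← hadd, show (k : ℝ) - m = -(θ * τ) by linarith]
    match_scalars
    · ring
    · ring
    · linear_combination hmc + c * hcn
  set E : Matrix V V ℝ := (θ - τ)⁻¹ • B with hE
  have hidem : IsIdempotentElem E := by
    rw [IsIdempotentElem, hE, Matrix.smul_mul, Matrix.mul_smul, hBB, inv_smul_smul₀ hd]
  have hEapp (v w : V) : E v w = (θ - τ)⁻¹ * (A v w - τ * (1 : Matrix V V ℝ) v w - c) := by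
    simp [hE, hB, hJ]
  refine ⟨E.rank, ?_, ?_⟩
  · rw [← Matrix.trace_eq_rank_of_isIdempotentElem hidem, hE, Matrix.trace_smul, smul_eq_mul,
      mul_comm, mul_inv_cancel_left₀ hd, hB, Matrix.trace_sub, Matrix.trace_sub,
      Matrix.trace_smul, Matrix.trace_smul, hA, trace_adjMatrix, Matrix.trace_one, h.card,
      show J.trace = n by simp [hJ, Matrix.trace, h.card]]
    simp only [smul_eq_mul]
    linear_combination -hcn
  · rw [← h.card]
    let S : Finset ℝ := {(θ - τ)⁻¹ * (-τ - c), (θ - τ)⁻¹ * (1 - c), (θ - τ)⁻¹ * (-c)}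
    refine (Matrix.card_le_card_pow_rank E (fun v w hvw ↦ ?_) S fun v w ↦ ?_).trans
      (Nat.pow_le_pow_left Finset.card_le_three _)
    · by_contra hne'
      have hv : E v v = E w v := congrFun hvw v
      rw [hEapp, hEapp, mul_right_inj' (inv_ne_zero hd)] at hv
      by_cases ha : G.Adj w v
      · simp [hA, ha, Matrix.one_apply_ne' hne'] at hv
        exact h1 (by linarith)
      · simp [hA, ha, Matrix.one_apply_ne' hne'] at hv
        exact h0 hv
    · rw [hEapp]
      obtain rfl | hn := eq_or_ne v w
      · simp [S, hA]
      · by_cases ha : G.Adj v w <;> simp [S, hA, ha, hn]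

end SimpleGraph.IsSRGWith

/-- A sum and a negative product determine two real numbers, the first of which may be chosen at
least half as large as their sum. -/
theorem exists_add_mul_eq_of_neg {d p : ℝ} (hp : p < 0) :
    ∃ θ τ : ℝ, θ + τ = d ∧ θ * τ = p ∧ |d| ≤ 2 * |θ| := by
  have hD : 0 ≤ d ^ 2 - 4 * p := by nlinarith [sq_nonneg d]
  have hs := Real.sq_sqrt hD
  set s := √(d ^ 2 - 4 * p)
  obtain ⟨a, b, hadd, hmul⟩ : ∃ a b : ℝ, a + b = d ∧ a * b = p :=
    ⟨(d + s) / 2, (d - s) / 2, by ring, by linear_combination -hs / 4⟩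
  have htri : |d| ≤ |a| + |b| := hadd ▸ abs_add_le a b
  rcases le_total |a| |b| with hab | hab
  · exact ⟨b, a, by rw [add_comm, hadd], by rw [mul_comm, hmul], by linarith⟩
  · exact ⟨a, b, hadd, hmul, by linarith⟩

/-- In a large nontrivial strongly regular graph, `l - m` is small compared to `n`. -/
theorem SimpleGraph.IsSRGWith.abs_sub_lt {V : Type*} [Fintype V] [Nonempty V] [DecidableEq V]
    {G : SimpleGraph V} [DecidableRel G.Adj] {n k l m : ℕ} (h : G.IsSRGWith n k l m)
    (hG : NontrivialSRG G) {η : ℝ} (hη : 0 < η) (hn : 3 ^ ⌊(2 / η + 1) / η⌋₊ < n) :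
    |(l : ℝ) - m| < η * n := by
  by_contra! hd
  obtain ⟨hmk, hlk⟩ := h.param_lt_of_nontrivial hG
  have hkn : k ≤ n := by
    obtain ⟨v⟩ := ‹Nonempty V›
    rw [← h.card, ← h.regular.degree_eq v]
    exact (G.degree_lt_card_verts v).le
  have hn0 : (0 : ℝ) < n := by exact_mod_cast (Nat.zero_le _).trans_lt hn
  have hmk' : (m : ℝ) < k := by exact_mod_cast hmk
  have hlk' : (l : ℝ) + 1 < k := by exact_mod_cast hlk
  have hkn' : (k : ℝ) ≤ n := by exact_mod_cast hkn
  have hm0 : (0 : ℝ) ≤ m := m.cast_nonneg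
  obtain ⟨θ, τ, hadd, hmul, hθ⟩ := exists_add_mul_eq_of_neg (d := (l : ℝ) - m) (sub_neg.2 hmk')
  have hne : θ ≠ τ := by
    rintro rfl
    nlinarith [mul_self_nonneg θ]
  have h0 : τ ≠ 0 := by
    rintro rfl
    linarith
  have h1 : τ ≠ -1 := by
    rintro rfl
    linarith
  obtain ⟨r, hr, hnr⟩ := h.exists_multiplicity hadd hmul hne h0 h1
  have hdiff : η * n ≤ |θ - τ| := by
    refine hd.trans ?_
    rw [← hadd, ← sq_le_sq]
    nlinarith
  have hτ : |τ| ≤ 2 / η := by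
    have hprod : |θ| * |τ| ≤ n := by
      rw [← abs_mul, hmul, abs_le]
      constructor <;> linarith
    rw [le_div_iff₀ hη]
    have : η * n * |τ| ≤ 2 * n := by nlinarith [abs_nonneg τ]
    nlinarith
  have hrle : (r : ℝ) ≤ (2 / η + 1) / η := by
    have hn1 : (1 : ℝ) ≤ n := by exact_mod_cast Nat.one_le_iff_ne_zero.2 (by exact_mod_cast hn0.ne')
    have hnum : r * |θ - τ| ≤ n * (2 / η + 1) := by
      rw [← abs_of_nonneg (r.cast_nonneg : (0 : ℝ) ≤ r), ← abs_mul, hr,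
        show -(n * τ) - (k - τ) = -((n - 1) * τ) + -k by ring]
      refine (abs_add_le _ _).trans ?_
      rw [abs_neg, abs_neg, abs_mul, abs_of_nonneg (sub_nonneg.2 hn1),
        abs_of_nonneg (k.cast_nonneg : (0 : ℝ) ≤ k)]
      nlinarith [abs_nonneg τ]
    rw [le_div_iff₀ hη]
    have : r * (η * n) ≤ n * (2 / η + 1) :=
      (mul_le_mul_of_nonneg_left hdiff r.cast_nonneg).trans hnum
    nlinarith
  exact absurd (hnr.trans (Nat.pow_le_pow_right (by norm_num) (Nat.le_floor hrle))) hn.not_ge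

/-- For every `ε > 0` there exists `N` such that every nontrivial strongly regular graph
with parameters `(n, k, λ, μ)` and `n ≥ N` satisfies `|λ − k²/n| < εn` and `|μ − k²/n| < εn`. -/
theorem srg_asymptotics (ε : ℝ) (hε : 0 < ε) :
    ∃ N : ℕ, ∀ (n k l m : ℕ) (G : SimpleGraph (Fin n)) (_ : DecidableRel G.Adj),
      G.IsSRGWith n k l m → NontrivialSRG G → N ≤ n →
      |(l : ℝ) - (k : ℝ) ^ 2 / n| < ε * n ∧ |(m : ℝ) - (k : ℝ) ^ 2 / n| < ε * n := by
  refine ⟨max (3 ^ ⌊(2 / (ε / 4) + 1) / (ε / 4)⌋₊ + 1) (⌊2 / ε⌋₊ + 1), ?_⟩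
  intro n k l m G _ h hG hN
  have hN1 : 3 ^ ⌊(2 / (ε / 4) + 1) / (ε / 4)⌋₊ < n := (le_max_left _ _).trans hN
  have hN2 : 2 / ε < n := Nat.lt_of_floor_lt ((le_max_right _ _).trans hN)
  have hn0 : (0 : ℝ) < n := (by positivity : (0 : ℝ) < 2 / ε).trans hN2
  have : Nonempty (Fin n) := ⟨⟨0, by exact_mod_cast hn0⟩⟩
  have hεn : 2 < ε * n := by rwa [div_lt_iff₀' hε] at hN2
  have hd := h.abs_sub_lt hG (by positivity : 0 < ε / 4) hN1
  have hmk : (m : ℝ) < k := by exact_mod_cast (h.param_lt_of_nontrivial hG).1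
  have hkn : (k : ℝ) ≤ n := by
    have := (G.degree_lt_card_verts (Classical.arbitrary _)).le
    rw [h.regular.degree_eq, Fintype.card_fin] at this
    exact_mod_cast this
  have hm0 : (0 : ℝ) ≤ m := m.cast_nonneg
  have hdev : |(m : ℝ) - k ^ 2 / n| ≤ 1 + ε / 4 * n := by
    have heq : (m : ℝ) - k ^ 2 / n = -(((k : ℝ) - m) + (l - m) * k) / n := by
      rw [eq_div_iff hn0.ne', sub_mul, div_mul_cancel₀ _ hn0.ne']
      linear_combination -h.degree_sq_eq
    rw [heq, abs_div, abs_neg, abs_of_pos hn0, div_le_iff₀ hn0]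
    refine (abs_add_le _ _).trans ?_
    rw [abs_mul, abs_of_pos (sub_pos.2 hmk), abs_of_nonneg (k.cast_nonneg : (0 : ℝ) ≤ k)]
    have : |(l : ℝ) - m| * k ≤ ε / 4 * n * n :=
      mul_le_mul hd.le hkn k.cast_nonneg (by positivity)
    linarith
  refine ⟨?_, by linarith⟩
  have htri := abs_add_le ((l : ℝ) - m) (m - k ^ 2 / n)
  rw [sub_add_sub_cancel] at htri
  linarith
end

section
/- Let {G_s} be a CSR(d, a, c) sequence of nontrivial strongly regular graphs. Then a = c = d². -/
open SimpleGraph Filter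

namespace Matrix

variable {K m n : Type*} [Field K] [Fintype n]

theorem exists_eq_mul_of_rank [Fintype m] (A : Matrix m n K) :
    ∃ (U : Matrix m (Fin A.rank) K) (W : Matrix (Fin A.rank) n K), A = U * W := by
  classical
  let b : Module.Basis (Fin A.rank) K (LinearMap.range A.mulVecLin) :=
    Module.finBasisOfFinrankEq K _ rfl
  let col (j : n) : LinearMap.range A.mulVecLin := ⟨A.mulVecLin (Pi.single j 1), _, rfl⟩
  refine ⟨of fun i r => (b r : m → K) i, of fun r j => b.repr (col j) r, ?_⟩
  ext i j
  have h := congrFun (congrArg Subtype.val (b.sum_repr (col j))) i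
  simp only [Submodule.coe_sum, Submodule.coe_smul, Finset.sum_apply, Pi.smul_apply,
    smul_eq_mul] at h
  rw [mul_apply]
  simp only [of_apply]
  rw [← (by simp [col] : (col j : m → K) i = A i j), ← h]
  exact Finset.sum_congr rfl fun r _ => mul_comm _ _

theorem rank_add_le [Fintype m] (A B : Matrix m n K) : (A + B).rank ≤ A.rank + B.rank := by
  rw [rank, rank, rank, mulVecLin_add]
  refine (Submodule.finrank_mono (LinearMap.range_add_le _ _)).trans ?_
  exact Submodule.finrank_add_le_finrank_add_finrank _ _

theorem rank_smul_le [Fintype m] (c : K) (A : Matrix m n K) : (c • A).rank ≤ A.rank := by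
  classical
  simpa using rank_mul_le_right (c • (1 : Matrix m m K)) A

theorem rank_hadamard_le [Fintype m] (A B : Matrix m n K) :
    (A.hadamard B).rank ≤ A.rank * B.rank := by
  obtain ⟨U, W, hA⟩ := A.exists_eq_mul_of_rank
  obtain ⟨X, Y, hB⟩ := B.exists_eq_mul_of_rank
  have h : A.hadamard B =
      (of fun i (r : Fin A.rank × Fin B.rank) => U i r.1 * X i r.2) *
      (of fun (r : Fin A.rank × Fin B.rank) j => W r.1 j * Y r.2 j) := by
    ext i j
    have hAij := congrFun (congrFun hA i) j
    have hBij := congrFun (congrFun hB i) j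
    rw [hadamard_apply, hAij, hBij, mul_apply, mul_apply, mul_apply, Finset.sum_mul_sum,
      Fintype.sum_prod_type]
    simp only [of_apply]
    exact Finset.sum_congr rfl fun r _ => Finset.sum_congr rfl fun t _ => by ring
  rw [h]
  refine (rank_mul_le_left _ _).trans ((rank_le_card_width _).trans ?_)
  simp

theorem rank_eq_trace_of_isIdempotentElem {P : Matrix n n K} (hP : IsIdempotentElem P) :
    (P.rank : K) = P.trace := by
  classical
  have h : IsIdempotentElem (toLin' P) := hP.map (toLinAlgEquiv' (R := K) (n := n))
  rw [← trace_toLin'_eq, (LinearMap.IsProj.trace (LinearMap.IsIdempotentElem.isProj_range _ h))]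
  rfl

theorem rank_smul_allOnes_le (c : K) : (c • (of fun _ _ => 1 : Matrix n n K)).rank ≤ 1 := by
  have h : c • (of fun _ _ => 1 : Matrix n n K) = vecMulVec (fun _ => c) fun _ => 1 := by
    ext; simp [vecMulVec_apply]
  rw [h]
  exact rank_vecMulVec_le _ _

end Matrix

/-- Two real numbers with prescribed sum and nonpositive product can be ordered so that the first
one dominates the sum. -/
theorem exists_add_eq_mul_eq_neg (s : ℝ) {q : ℝ} (hq : 0 ≤ q) :
    ∃ θ τ : ℝ, θ + τ = s ∧ θ * τ = -q ∧ |s| ≤ |θ| ∧ |s| ≤ |θ - τ| := by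
  have hD : 0 ≤ s ^ 2 + 4 * q := by positivity
  have hr := Real.sq_sqrt hD
  have hs : |s| ≤ √(s ^ 2 + 4 * q) := Real.abs_le_sqrt (by linarith)
  have hr0 := Real.sqrt_nonneg (s ^ 2 + 4 * q)
  set r := √(s ^ 2 + 4 * q)
  rcases le_total 0 s with h0 | h0
  · rw [abs_of_nonneg h0] at hs ⊢
    refine ⟨(s + r) / 2, (s - r) / 2, by ring, by linear_combination -hr / 4, ?_, ?_⟩
    · exact le_trans (by linarith) (le_abs_self _)
    · exact le_trans (by linarith) (le_abs_self _)
  · rw [abs_of_nonpos h0] at hs ⊢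
    refine ⟨(s - r) / 2, (s + r) / 2, by ring, by linear_combination -hr / 4, ?_, ?_⟩
    · exact le_trans (by linarith) (neg_le_abs _)
    · exact le_trans (by linarith) (neg_le_abs _)

namespace SimpleGraph.IsSRGWith

variable {V : Type*} [Fintype V] {G : SimpleGraph V} [DecidableRel G.Adj] {n k l m : ℕ}

theorem nonadj_param_lt_degree (h : G.IsSRGWith n k l m) (hG : NontrivialSRG G) : m < k := by
  classical
  obtain ⟨-, u, v, w, huv, hvw, huw, hadj⟩ := hG
  rw [compl_adj] at huv hvw hadj
  have hadj : G.Adj u w := by tauto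
  have key {x y : V} (hxy : x ≠ y ∧ ¬ G.Adj x y) :
      (G.neighborFinset x ∩ G.neighborFinset y).card = m := by
    rw [← h.of_not_adj hxy.1 hxy.2, ← Set.toFinset_card]
    congr 1; ext; simp [mem_commonNeighbors]
  have hdeg (x : V) : (G.neighborFinset x).card = k := h.regular x
  have hle : m ≤ k := by
    rw [← key huv, ← hdeg u]; exact Finset.card_le_card Finset.inter_subset_left
  refine lt_of_le_of_ne hle fun hmk => ?_
  have sub {x y : V} (hxy : x ≠ y ∧ ¬ G.Adj x y) : G.neighborFinset x ⊆ G.neighborFinset y := by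
    rw [← Finset.inter_eq_left]
    exact Finset.eq_of_subset_of_card_le Finset.inter_subset_left (by rw [key hxy, hdeg, hmk])
  have : w ∈ G.neighborFinset w := sub hvw (sub huv (by simpa using hadj))
  simp at this

theorem adj_param_add_one_lt_degree (h : G.IsSRGWith n k l m) (hG : NontrivialSRG G) :
    l + 1 < k := by
  classical
  obtain ⟨⟨u, v, w, huv, hvw, huw, hadj⟩, -⟩ := hG
  have hl : (G.neighborFinset v ∩ G.neighborFinset u).card = l := by
    rw [← h.of_adj v u huv.symm, ← Set.toFinset_card]
    congr 1; ext; simp [mem_commonNeighbors]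
  have hdeg : (G.neighborFinset v).card = k := h.regular v
  have hu : u ∉ G.neighborFinset v ∩ G.neighborFinset u := by simp
  have hw : w ∉ insert u (G.neighborFinset v ∩ G.neighborFinset u) := by
    simp [hadj, huw.symm]
  have hsub : insert w (insert u (G.neighborFinset v ∩ G.neighborFinset u)) ⊆
      G.neighborFinset v := by
    intro x; simp only [Finset.mem_insert, Finset.mem_inter, mem_neighborFinset]
    rintro (rfl | rfl | hx)
    exacts [hvw, huv.symm, hx.1]
  have := Finset.card_le_card hsub
  rw [Finset.card_insert_of_notMem hw, Finset.card_insert_of_notMem hu, hl, hdeg] at this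
  omega

open Matrix

theorem adjMatrix_mul_self_eq [DecidableEq V] (h : G.IsSRGWith n k l m) :
    G.adjMatrix ℝ * G.adjMatrix ℝ = ((l : ℝ) - m) • G.adjMatrix ℝ + ((k : ℝ) - m) • 1 +
      (m : ℝ) • of fun _ _ => 1 := by
  have hJ : Gᶜ.adjMatrix ℝ = (of fun _ _ => 1) - 1 - G.adjMatrix ℝ := by
    ext i j
    by_cases hij : i = j
    · subst hij; simp
    · by_cases hA : G.Adj i j <;> simp [hij, hA]
  rw [← sq, h.matrix_eq, hJ]
  simp only [← Nat.cast_smul_eq_nsmul ℝ]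
  module

theorem adjMatrix_mul_allOnes (h : G.IsSRGWith n k l m) :
    G.adjMatrix ℝ * (of fun _ _ => 1) = (k : ℝ) • of fun _ _ => 1 := by
  ext i j
  simp [adjMatrix_mul_apply, h.regular.degree_eq i]

theorem allOnes_mul_adjMatrix (h : G.IsSRGWith n k l m) :
    (of fun _ _ => 1) * G.adjMatrix ℝ = (k : ℝ) • of fun _ _ => 1 := by
  ext i j
  simp [mul_adjMatrix_apply, h.regular.degree_eq j]

theorem degree_mul_degree (h : G.IsSRGWith n k l m) (hn : 0 < n) :
    (k : ℝ) * k = (l - m) * k + (k - m) + m * n := by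
  classical
  obtain ⟨v⟩ := Fintype.card_pos_iff.1 (h.card ▸ hn)
  have e := congrArg (fun M : Matrix V V ℝ => (M * (of fun _ _ => 1 : Matrix V V ℝ)) v v) h.adjMatrix_mul_self_eq
  simp only [Matrix.mul_assoc, Matrix.add_mul, h.adjMatrix_mul_allOnes, Matrix.smul_mul,
    Matrix.mul_smul, Matrix.one_mul] at e
  simpa [mul_apply, h.card] using e

/-- A form of the absolute bound for strongly regular graphs. -/
theorem card_le_sq (h : G.IsSRGWith n k l m) (hG : NontrivialSRG G) (hn : 0 < n) {θ τ : ℝ}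
    (hadd : θ + τ = (l : ℝ) - m) (hmul : θ * τ = -((k : ℝ) - m)) (hne : θ - τ ≠ 0) :
    (n : ℝ) ≤ ((-(n * τ) - (k - τ)) / (θ - τ) + 1) ^ 2 := by
  classical
  have hmk : (m : ℝ) < k := by exact_mod_cast h.nonadj_param_lt_degree hG
  have hlk : (l : ℝ) + 1 < k := by exact_mod_cast h.adj_param_add_one_lt_degree hG
  have hn' : (n : ℝ) ≠ 0 := by positivity
  set A := G.adjMatrix ℝ with hA
  set J : Matrix V V ℝ := of fun _ _ => 1 with hJ
  have hAA : A * A = ((l : ℝ) - m) • A + ((k : ℝ) - m) • 1 + (m : ℝ) • J :=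
    h.adjMatrix_mul_self_eq
  have hAJ : A * J = (k : ℝ) • J := h.adjMatrix_mul_allOnes
  have hJA : J * A = (k : ℝ) • J := h.allOnes_mul_adjMatrix
  have hJJ : J * J = (n : ℝ) • J := by
    ext i j; simp [hJ, mul_apply, h.card]
  obtain ⟨c, hc⟩ : ∃ c : ℝ, c * n = k - τ := ⟨(k - τ) / n, div_mul_cancel₀ _ hn'⟩
  have hm : (m : ℝ) = c * (k - θ) := by
    refine mul_right_cancel₀ hn' ?_
    linear_combination -(h.degree_mul_degree hn) - (k - θ) * hc + k * hadd - hmul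
  set P : Matrix V V ℝ := (θ - τ)⁻¹ • (A - τ • 1 - c • J) with hP
  have hPP : IsIdempotentElem P := by
    have hk : (k : ℝ) = c * n + τ := by linarith
    have hM : (A - τ • 1 - c • J) * (A - τ • 1 - c • J) = (θ - τ) • (A - τ • 1 - c • J) := by
      simp only [sub_mul, mul_sub, smul_mul_assoc, mul_smul_comm, hAA, hAJ, hJA, hJJ, one_mul,
        mul_one]
      rw [← hadd, show (k : ℝ) - m = -(θ * τ) by linarith, hm, hk]
      module
    rw [IsIdempotentElem, hP, smul_mul_smul_comm, hM, smul_smul]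
    congr 1
    field_simp
  have hrank : (P.rank : ℝ) = (-(n * τ) - (k - τ)) / (θ - τ) := by
    rw [rank_eq_trace_of_isIdempotentElem hPP, hP]
    simp only [trace_smul, trace_sub, hA, trace_adjMatrix, trace_one, h.card, smul_eq_mul]
    have : J.trace = n := by simp [hJ, trace, h.card]
    rw [this, hc]
    field_simp
    ring
  have hbound (d : ℝ) : (A - τ • 1 - d • J).rank ≤ P.rank + 1 := by
    have : A - τ • 1 - d • J = (θ - τ) • P + (c - d) • J := by
      rw [hP, smul_smul, mul_inv_cancel₀ hne]; module
    rw [this]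
    exact (rank_add_le _ _).trans
      (add_le_add (rank_smul_le _ _) (rank_smul_allOnes_le _))
  have hdiag : (A - τ • 1 - (0 : ℝ) • J).hadamard (A - τ • 1 - (1 : ℝ) • J) =
      (τ * (τ + 1)) • (1 : Matrix V V ℝ) := by
    ext i j
    by_cases hij : i = j
    · subst hij; simp [hA, hJ]; ring
    · by_cases hadj : G.Adj i j <;> simp [hA, hJ, hij, hadj]
  have hτ : τ * (τ + 1) ≠ 0 := by
    refine mul_ne_zero (fun h0 => ?_) fun h1 => ?_
    · rw [h0] at hmul; linarith
    · have : τ = -1 := by linarith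
      subst this; linarith
  have hfull : ((τ * (τ + 1)) • (1 : Matrix V V ℝ)).rank = n := by
    rw [← h.card]
    refine rank_of_isUnit _ ?_
    rw [Matrix.isUnit_iff_isUnit_det]
    simp [hτ, -mul_eq_zero]
  have key : n ≤ (P.rank + 1) * (P.rank + 1) := by
    rw [← hfull, ← hdiag]
    exact (rank_hadamard_le _ _).trans (Nat.mul_le_mul (hbound 0) (hbound 1))
  rw [← hrank, sq]
  exact_mod_cast key

theorem card_le_of_le_abs_sub (h : G.IsSRGWith n k l m) (hG : NontrivialSRG G) (hn : 0 < n)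
    {ε : ℝ} (hε : 0 < ε) (hle : ε * n ≤ |(l : ℝ) - m|) :
    (n : ℝ) ≤ (((1 / ε) + 1) / ε + 1) ^ 2 := by
  classical
  have hmk : (m : ℝ) < k := by exact_mod_cast h.nonadj_param_lt_degree hG
  have hn0 : (0 : ℝ) < n := by exact_mod_cast hn
  have hn1 : (1 : ℝ) ≤ n := by exact_mod_cast hn
  have hkn : (k : ℝ) ≤ n := by
    obtain ⟨v⟩ := Fintype.card_pos_iff.1 (h.card ▸ hn)
    rw [← h.card, ← h.regular v]
    exact_mod_cast (G.degree_lt_card_verts v).le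
  obtain ⟨θ, τ, hadd, hmul, hθ, hδ⟩ :=
    exists_add_eq_mul_eq_neg ((l : ℝ) - m) (sub_nonneg.2 hmk.le)
  have hεn : 0 < ε * n := by positivity
  have hδ0 : 0 < |θ - τ| := hεn.trans_le (hle.trans hδ)
  have hτ : |τ| ≤ 1 / ε := by
    rw [le_div_iff₀ hε]
    have h1 : |θ| * |τ| = k - m := by
      rw [← abs_mul, hmul, abs_neg, abs_of_pos (by linarith)]
    have h2 : ε * n * |τ| ≤ n := calc
      ε * n * |τ| ≤ |θ| * |τ| := by gcongr; exact hle.trans hθ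
      _ ≤ n := by rw [h1]; linarith [Nat.cast_nonneg (α := ℝ) m]
    nlinarith
  refine (h.card_le_sq hG hn hadd hmul (abs_pos.1 hδ0)).trans ?_
  have hN : |(-(n * τ) - (k - τ)) / (θ - τ)| ≤ (1 / ε + 1) / ε := by
    rw [abs_div, div_le_div_iff₀ hδ0 hε]
    have h1 : |-(n * τ) - (k - τ)| ≤ n * (1 / ε + 1) := by
      obtain ⟨hτ1, hτ2⟩ := abs_le.1 hτ
      have hk0 := Nat.cast_nonneg (α := ℝ) k
      have hε' : 0 < 1 / ε := by positivity
      rw [abs_le]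
      constructor <;> nlinarith
    calc |-(n * τ) - (k - τ)| * ε ≤ n * (1 / ε + 1) * ε := by gcongr
      _ = (1 / ε + 1) * (ε * n) := by ring
      _ ≤ (1 / ε + 1) * |θ - τ| := by gcongr; exact hle.trans hδ
  obtain ⟨hN1, hN2⟩ := abs_le.1 hN
  exact sq_le_sq' (by linarith) (by linarith)

end SimpleGraph.IsSRGWith

/-- If `{G_s}` is a `CSR(d, a, c)` sequence of nontrivial strongly regular graphs,
then `a = c = d²`. -/
theorem csr_seq_params (d a c : ℝ) (hd : 0 ≤ d) (ha : 0 ≤ a) (hc : 0 ≤ c)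
    (n k l m : ℕ → ℕ) (G : ∀ s : ℕ, SimpleGraph (Fin (n s)))
    (inst : ∀ s, DecidableRel (G s).Adj)
    (hmono : StrictMono n)
    (hsrg : ∀ s, (G s).IsSRGWith (n s) (k s) (l s) (m s))
    (hnontriv : ∀ s, NontrivialSRG (G s))
    (hk : Tendsto (fun s => (k s : ℝ) / (n s : ℝ)) atTop (nhds d))
    (hl : Tendsto (fun s => (l s : ℝ) / (n s : ℝ)) atTop (nhds a))
    (hm : Tendsto (fun s => (m s : ℝ) / (n s : ℝ)) atTop (nhds c)) :
    a = c ∧ c = d ^ 2 := by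
  have hpos : ∀ᶠ s in atTop, 0 < n s :=
    (eventually_gt_atTop 0).mono fun s hs => hs.trans_le (hmono.id_le s)
  have hn : Tendsto (fun s => (n s : ℝ)) atTop atTop :=
    tendsto_natCast_atTop_atTop.comp hmono.tendsto_atTop
  have hac : a = c := by
    by_contra hne
    have hε : 0 < |a - c| / 2 := half_pos (abs_pos.2 (sub_ne_zero.2 hne))
    have hgap := (hl.sub hm).abs.eventually (lt_mem_nhds (show |a - c| / 2 < |a - c| by linarith))
    obtain ⟨s, hs, hs0, hlarge⟩ :=
      (hgap.and (hpos.and (hn.eventually_gt_atTop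
        ((((1 / (|a - c| / 2)) + 1) / (|a - c| / 2) + 1) ^ 2)))).exists
    refine hlarge.not_ge ((hsrg s).card_le_of_le_abs_sub (hnontriv s) hs0 hε ?_)
    have hs0' : (0 : ℝ) < n s := by exact_mod_cast hs0
    rw [← sub_div, abs_div, abs_of_pos hs0', lt_div_iff₀ hs0'] at hs
    exact hs.le
  refine ⟨hac, ?_⟩
  have hlim := (((hl.sub hm).mul hk).add ((hk.sub hm).mul hn.inv_tendsto_atTop)).add hm
  have hsq := tendsto_nhds_unique (hk.pow 2) (hlim.congr' ?_)
  · rw [hsq, hac]; ring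
  · filter_upwards [hpos] with s hs
    have hs' : (n s : ℝ) ≠ 0 := by positivity
    have e := (hsrg s).degree_mul_degree hs
    simp only [Pi.inv_apply]
    field_simp
    linear_combination -e
end

section
/- If 0 < d < 1 and {G_s} is a CSR(d, a, c) sequence of nontrivial strongly regular graphs, then d ≠ a and d ≠ c. -/
open SimpleGraph Filter

namespace SimpleGraph

variable {V : Type*} [Fintype V] (G : SimpleGraph V) [DecidableRel G.Adj]

theorem card_commonNeighbors_add_le (u v w : V) :
    Fintype.card (G.commonNeighbors v u) + Fintype.card (G.commonNeighbors v w) ≤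
      G.degree v + Fintype.card (G.commonNeighbors u w) := by
  classical
  have hcard (x y : V) : Fintype.card (G.commonNeighbors x y) =
      (G.neighborFinset x ∩ G.neighborFinset y).card :=
    Fintype.card_of_subtype _ fun z => by simp [mem_commonNeighbors]
  rw [hcard, hcard, hcard, ← card_neighborFinset_eq_degree, ← Finset.card_union_add_card_inter]
  exact Nat.add_le_add (Finset.card_le_card (by grind)) (Finset.card_le_card (by grind))

variable {G} {n k l m : ℕ}

theorem IsSRGWith.two_mul_le_of_adj (h : G.IsSRGWith n k l m) {u v w : V}
    (huv : G.Adj u v) (hvw : G.Adj v w) (hne : u ≠ w) (huw : ¬G.Adj u w) :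
    2 * l ≤ k + m := by
  have := G.card_commonNeighbors_add_le u v w
  rw [h.of_adj _ _ huv.symm, h.of_adj _ _ hvw, h.of_not_adj hne huw, h.regular v] at this
  lia

theorem IsSRGWith.two_mul_le_of_not_adj (h : G.IsSRGWith n k l m) {u v w : V}
    (huv : Gᶜ.Adj u v) (hvw : Gᶜ.Adj v w) (huw : G.Adj u w) :
    2 * m ≤ k + l := by
  have := G.card_commonNeighbors_add_le u v w
  rw [compl_adj] at huv hvw
  rw [h.of_not_adj huv.1.symm (mt Adj.symm huv.2), h.of_not_adj hvw.1 hvw.2, h.of_adj _ _ huw,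
    h.regular v] at this
  lia

/-- The parameter identity of a strongly regular graph, scaled by the square of the order. -/
theorem IsSRGWith.density_eq (h : G.IsSRGWith n k l m) {u v : V} (huv : G.Adj u v) :
    (k / n : ℝ) * (k / n - l / n - 1 / n) = (1 - k / n - 1 / n) * (m / n) := by
  have hlk : l < k := by
    simpa [h.of_adj u v huv, h.regular u] using huv.card_commonNeighbors_lt_degree
  have hkn : k < n := by
    simpa [h.regular u, h.card] using G.degree_lt_card_verts u
  have key := h.param_eq G (by lia)
  obtain ⟨p, rfl⟩ := Nat.exists_eq_add_of_lt hlk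
  obtain ⟨q, rfl⟩ := Nat.exists_eq_add_of_lt hkn
  have h1 : l + p + 1 - l - 1 = p := by lia
  have h2 : l + p + 1 + q + 1 - (l + p + 1) - 1 = q := by lia
  rw [h1, h2] at key
  have key' : ((l + p + 1 : ℝ)) * p = q * m := by exact_mod_cast key
  have hn : ((l + p + 1 + q + 1 : ℕ) : ℝ) ≠ 0 := by positivity
  field_simp
  push_cast
  linear_combination key'

end SimpleGraph

/-- If `{G_s}` is a `CSR(d, a, c)` sequence of nontrivial strongly regular graphs,
then `d ≠ a` and `d ≠ c`, provided `0 < d < 1`. -/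
theorem csr_seq_d_ne (d a c : ℝ) (hd0 : 0 < d) (hd1 : d < 1) (hd : 0 ≤ d) (ha : 0 ≤ a) (hc : 0 ≤ c)
    (n k l m : ℕ → ℕ) (G : ∀ s : ℕ, SimpleGraph (Fin (n s)))
    (inst : ∀ s, DecidableRel (G s).Adj)
    (hmono : StrictMono n)
    (hsrg : ∀ s, (G s).IsSRGWith (n s) (k s) (l s) (m s))
    (hnontriv : ∀ s, NontrivialSRG (G s))
    (hk : Tendsto (fun s => (k s : ℝ) / (n s : ℝ)) atTop (nhds d))
    (hl : Tendsto (fun s => (l s : ℝ) / (n s : ℝ)) atTop (nhds a))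
    (hm : Tendsto (fun s => (m s : ℝ) / (n s : ℝ)) atTop (nhds c)) :
    d ≠ a ∧ d ≠ c := by
  have hn : Tendsto (fun s => (1 : ℝ) / (n s : ℝ)) atTop (nhds 0) :=
    tendsto_one_div_atTop_nhds_zero_nat.comp hmono.tendsto_atTop
  have hparam : d * (d - a - 0) = (1 - d - 0) * c := by
    refine tendsto_nhds_unique (hk.mul ((hk.sub hl).sub hn)) ?_
    refine (((hk.const_sub 1).sub hn).mul hm).congr fun s => ?_
    obtain ⟨u, v, w, huv, -⟩ := (hnontriv s).1
    exact ((hsrg s).density_eq huv).symm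
  have hadj : 2 * a ≤ d + c := by
    refine le_of_tendsto_of_tendsto' (hl.const_mul 2) (hk.add hm) fun s => ?_
    obtain ⟨u, v, w, huv, hvw, hne, huw⟩ := (hnontriv s).1
    have h : (2 * l s : ℝ) ≤ k s + m s := by
      exact_mod_cast (hsrg s).two_mul_le_of_adj huv hvw hne huw
    rw [← add_div, ← mul_div_assoc]
    gcongr
  have hnadj : 2 * c ≤ d + a := by
    refine le_of_tendsto_of_tendsto' (hm.const_mul 2) (hk.add hl) fun s => ?_
    obtain ⟨u, v, w, huv, hvw, hne, huw⟩ := (hnontriv s).2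
    have huw' : (G s).Adj u w := by simpa [compl_adj, hne] using huw
    have h : (2 * m s : ℝ) ≤ k s + l s := by
      exact_mod_cast (hsrg s).two_mul_le_of_not_adj huv hvw huw'
    rw [← add_div, ← mul_div_assoc]
    gcongr
  constructor
  · rintro rfl
    nlinarith [mul_pos (sub_pos.2 hd1) hd0]
  · rintro rfl
    nlinarith [mul_pos (sub_pos.2 hd1) hd0]
end

section
/- Let ε > 0, r ≥ 1 be an integer, and let (A, B) be an ε-uniform pair of disjoint vertex sets in a graph G with density d(A, B) = d. Then at least (1 − ε·φ(r))·C(|A|, r) of the r-element subsets R of A satisfy d̂_B(R) − d^r·|B| > −ε·r·|B|, where φ(r) = r!·∑_{i=0}^{r−1} 1/i! and C(|A|, r) is the binomial coefficient. -/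
open SimpleGraph Finset

/-- `φ(r) = r! ∑_{i=0}^{r-1} 1/i!`. -/
noncomputable def phi (r : ℕ) : ℝ :=
  (Nat.factorial r : ℝ) * ∑ i ∈ Finset.range r, (1 : ℝ) / (Nat.factorial i : ℝ)

/-- The codegree `d̂_Y(R)`: the number of vertices of `Y` adjacent in `G` to
every vertex of `R`. -/
def codeg {V : Type*} (G : SimpleGraph V) [DecidableRel G.Adj]
    (Y : Finset V) (R : Finset V) : ℕ :=
  #(Y.filter fun y => ∀ r ∈ R, G.Adj y r)

lemma phi_one : phi 1 = 1 := by simp [phi]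

lemma phi_succ (r : ℕ) : phi (r + 1) = (r + 1) * (phi r + 1) := by
  have h : (r.factorial : ℝ) ≠ 0 := by positivity
  simp only [phi, Finset.sum_range_succ, Nat.factorial_succ]
  push_cast
  field_simp

lemma one_le_phi {r : ℕ} (hr : 1 ≤ r) : 1 ≤ phi r := by
  induction r, hr using Nat.le_induction with
  | base => rw [phi_one]
  | succ n hn ih =>
    rw [phi_succ]
    nlinarith [(Nat.cast_nonneg n : (0 : ℝ) ≤ n)]

lemma succ_mul_card_filter_powersetCard_succ_le {V : Type*} [DecidableEq V] (A : Finset V) (r : ℕ)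
    (P : Finset V → Prop) [DecidablePred P] :
    (r + 1) * #((A.powersetCard (r + 1)).filter P) ≤
      ∑ R ∈ A.powersetCard r, #((A \ R).filter fun x => P (insert x R)) := by
  have h : (r + 1) * #((A.powersetCard (r + 1)).filter P) =
      #(((A.powersetCard (r + 1)).filter P).sigma fun S => S) := by
    rw [card_sigma, sum_const_nat (m := r + 1), mul_comm]
    intro S hS
    exact (mem_powersetCard.1 (mem_filter.1 hS).1).2
  rw [h, ← card_sigma]
  refine card_le_card_of_injOn (fun p => ⟨p.1.erase p.2, p.2⟩) ?_ ?_
  · rintro ⟨S, x⟩ hS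
    simp only [coe_sigma, Set.mem_sigma_iff, mem_coe, mem_filter, mem_powersetCard,
      mem_sdiff, notMem_erase, not_false_eq_true, and_true] at hS ⊢
    obtain ⟨⟨⟨hSA, hcard⟩, hP⟩, hx⟩ := hS
    refine ⟨⟨(erase_subset _ _).trans hSA, ?_⟩, hSA hx, ?_⟩
    · rw [card_erase_of_mem hx, hcard, Nat.add_sub_cancel]
    · rwa [insert_erase hx]
  · rintro ⟨S, x⟩ hS ⟨T, y⟩ hT hST
    simp only [coe_sigma, Set.mem_sigma_iff, mem_coe] at hS hT
    simp only [Sigma.mk.injEq, heq_eq_eq] at hST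
    obtain ⟨h1, rfl⟩ := hST
    have : S = T := by rw [← insert_erase hS.2, h1, insert_erase hT.2]
    subst this
    rfl

lemma card_filter_low_degree_lt {V : Type*} [DecidableEq V] {G : SimpleGraph V}
    [DecidableRel G.Adj] {ε : ℝ} (hε : 0 < ε) {A B Y : Finset V} (hA : A.Nonempty)
    (hB : B.Nonempty) (hunif : G.IsUniform ε A B) (hYB : Y ⊆ B) (hY : ε * #B ≤ #Y) :
    (#(A.filter fun x => (#(Y.filter fun y => G.Adj y x) : ℝ) ≤
      ((G.edgeDensity A B : ℝ) - ε) * #Y) : ℝ) < ε * #A := by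
  set X := A.filter fun x => (#(Y.filter fun y => G.Adj y x) : ℝ) ≤
      ((G.edgeDensity A B : ℝ) - ε) * #Y with hX
  by_contra! hXA
  have hApos : (0 : ℝ) < #A := by exact_mod_cast hA.card_pos
  have hBpos : (0 : ℝ) < #B := by exact_mod_cast hB.card_pos
  have hXpos : (0 : ℝ) < #X := (mul_pos hε hApos).trans_le hXA
  have hYpos : (0 : ℝ) < #Y := (mul_pos hε hBpos).trans_le hY
  have hlt := hunif (filter_subset _ _) hYB (by rwa [mul_comm]) (by rwa [mul_comm])
  have hedges : (#(G.interedges X Y) : ℝ) ≤ #X * (((G.edgeDensity A B : ℝ) - ε) * #Y) := by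
    have : #(G.interedges X Y) = ∑ x ∈ X, #(Y.filter fun y => G.Adj y x) := by
      simp only [SimpleGraph.interedges, Rel.interedges, card_filter, sum_product, G.adj_comm]
    rw [this, Nat.cast_sum, ← nsmul_eq_mul]
    exact sum_le_card_nsmul _ _ _ fun x hx => (mem_filter.1 hx).2
  have hdens : (G.edgeDensity X Y : ℝ) ≤ (G.edgeDensity A B : ℝ) - ε := by
    rw [G.edgeDensity_def X Y]
    push_cast
    rw [div_le_iff₀ (by positivity)]
    linarith
  linarith [(abs_lt.1 hlt).1]

lemma codeg_insert {V : Type*} [DecidableEq V] (G : SimpleGraph V) [DecidableRel G.Adj]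
    (Y R : Finset V) (x : V) :
    codeg G Y (insert x R) =
      #((Y.filter fun y => ∀ r ∈ R, G.Adj y r).filter fun y => G.Adj y x) := by
  simp only [codeg, filter_filter, forall_mem_insert, and_comm]

lemma card_filter_low_codeg_insert_le {V : Type*} [DecidableEq V] {G : SimpleGraph V}
    [DecidableRel G.Adj] {ε : ℝ} (hε : 0 < ε) {A B : Finset V} (hA : A.Nonempty)
    (hB : B.Nonempty) (hunif : G.IsUniform ε A B) {d : ℝ} (hd : d = (G.edgeDensity A B : ℝ))
    {r : ℕ} {R : Finset V} (hR : (d ^ r - ε * r) * #B ≤ codeg G B R) (C : Finset V)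
    (hC : C ⊆ A) :
    (#(C.filter fun x => (codeg G B (insert x R) : ℝ) ≤
      (d ^ (r + 1) - ε * (r + 1 : ℕ)) * #B) : ℝ) ≤ ε * #A := by
  have hd0 : 0 ≤ d := by rw [hd]; exact_mod_cast G.edgeDensity_nonneg A B
  have hd1 : d ≤ 1 := by rw [hd]; exact_mod_cast G.edgeDensity_le_one A B
  have hBpos : (0 : ℝ) < #B := by exact_mod_cast hB.card_pos
  have hr0 : (0 : ℝ) ≤ r := r.cast_nonneg
  have hdr0 : 0 ≤ d ^ r := pow_nonneg hd0 r
  have hdr1 : d ^ r ≤ 1 := pow_le_one₀ hd0 hd1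
  have hempty : d ^ (r + 1) - ε * (r + 1 : ℕ) < 0 →
      (#(C.filter fun x => (codeg G B (insert x R) : ℝ) ≤
        (d ^ (r + 1) - ε * (r + 1 : ℕ)) * #B) : ℝ) ≤ ε * #A := by
    intro h
    rw [filter_false_of_mem]
    · simpa using by positivity
    · intro x _
      exact not_le.2 ((mul_neg_of_neg_of_pos h hBpos).trans_le (Nat.cast_nonneg _))
  push_cast at hempty ⊢
  rcases lt_or_ge (d ^ r - ε * r) ε with h1 | h1
  · refine hempty ?_
    rw [pow_succ]
    nlinarith
  rcases lt_or_ge d ε with h2 | h2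
  · refine hempty ?_
    rw [pow_succ]
    nlinarith
  refine le_trans ?_ (card_filter_low_degree_lt (Y := B.filter fun y => ∀ r ∈ R, G.Adj y r)
    hε hA hB hunif (filter_subset _ _) ?_).le
  · refine Nat.cast_le.2 (card_le_card ?_)
    intro x hx
    rw [mem_filter] at hx ⊢
    refine ⟨hC hx.1, ?_⟩
    rw [← codeg_insert, ← hd]
    refine hx.2.trans (le_trans ?_ (mul_le_mul_of_nonneg_left hR (sub_nonneg.2 h2)))
    rw [← mul_assoc]
    refine mul_le_mul_of_nonneg_right ?_ hBpos.le
    rw [pow_succ]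
    nlinarith [mul_nonneg (mul_nonneg hε.le hr0) (sub_nonneg.2 hd1),
      mul_nonneg hε.le (sub_nonneg.2 hdr1), mul_nonneg (mul_nonneg hε.le hε.le) hr0]
  · exact (mul_le_mul_of_nonneg_right h1 hBpos.le).trans hR

lemma card_filter_low_codeg_le {V : Type*} [DecidableEq V] {G : SimpleGraph V}
    [DecidableRel G.Adj] {ε : ℝ} (hε : 0 < ε) {A B : Finset V} (hA : A.Nonempty)
    (hB : B.Nonempty) (hunif : G.IsUniform ε A B) {d : ℝ} (hd : d = (G.edgeDensity A B : ℝ))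
    {r : ℕ} (hr : 1 ≤ r) :
    (#((A.powersetCard r).filter fun R => (codeg G B R : ℝ) ≤ (d ^ r - ε * r) * #B) : ℝ) ≤
      ε * phi r * (#A).choose r := by
  induction r, hr using Nat.le_induction with
  | base =>
    have hcount := succ_mul_card_filter_powersetCard_succ_le A 0
      fun R => (codeg G B R : ℝ) ≤ (d ^ (0 + 1) - ε * (0 + 1 : ℕ)) * #B
    rw [powersetCard_zero, sum_singleton] at hcount
    have hvert := card_filter_low_codeg_insert_le (r := 0) (R := ∅) hε hA hB hunif hd
      (by simp [codeg]) (A \ ∅) sdiff_subset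
    simp only [zero_add, one_mul] at hcount hvert
    rw [phi_one, mul_one, Nat.choose_one_right]
    exact (Nat.cast_le.2 hcount).trans hvert
  | succ r hr ih =>
    rcases lt_or_ge (#A) (r + 1) with hlt | hge
    · rw [powersetCard_eq_empty.2 hlt, Nat.choose_eq_zero_of_lt hlt]
      simp
    have hcount := succ_mul_card_filter_powersetCard_succ_le A r
      fun R => (codeg G B R : ℝ) ≤ (d ^ (r + 1) - ε * (r + 1 : ℕ)) * #B
    have hfiber : ∀ R ∈ A.powersetCard r,
        (#((A \ R).filter fun x => (codeg G B (insert x R) : ℝ) ≤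
          (d ^ (r + 1) - ε * (r + 1 : ℕ)) * #B) : ℝ) ≤
        (if (codeg G B R : ℝ) ≤ (d ^ r - ε * r) * #B then (#A - r : ℝ) else 0) + ε * #A := by
      intro R hR
      obtain ⟨hRA, hRcard⟩ := mem_powersetCard.1 hR
      split_ifs with hbad
      · have h1 : (#(A \ R) : ℝ) = #A - r := by
          rw [cast_card_sdiff hRA, hRcard]
        have h2 : (0 : ℝ) ≤ ε * #A := by positivity
        have h3 := Nat.cast_le (α := ℝ) |>.2 <| card_filter_le (A \ R) fun x =>
          (codeg G B (insert x R) : ℝ) ≤ (d ^ (r + 1) - ε * (r + 1 : ℕ)) * #B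
        linarith
      · rw [zero_add]
        exact card_filter_low_codeg_insert_le hε hA hB hunif hd (not_le.1 hbad).le _ sdiff_subset
    have hsum := sum_le_sum hfiber
    rw [sum_add_distrib, ← sum_filter, sum_const, sum_const, card_powersetCard, nsmul_eq_mul,
      nsmul_eq_mul] at hsum
    rw [← Nat.cast_le (α := ℝ)] at hcount
    push_cast at hcount hsum ⊢
    have hchoose : ((#A).choose (r + 1) : ℝ) * (r + 1) = (#A).choose r * (#A - r) := by
      have := Nat.choose_succ_right_eq (#A) r
      rw [← Nat.cast_sub (by omega)]
      exact_mod_cast this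
    have hge' : (r : ℝ) + 1 ≤ #A := by exact_mod_cast hge
    have hr0 : (0 : ℝ) ≤ r := r.cast_nonneg
    have hc0 : (0 : ℝ) ≤ (#A).choose r := Nat.cast_nonneg _
    have hphi := one_le_phi hr
    have hmul := mul_le_mul_of_nonneg_right ih (by linarith : (0 : ℝ) ≤ #A - r)
    have hA_le : (#A : ℝ) ≤ (r + 1) * (#A - r) := by nlinarith
    refine le_of_mul_le_mul_left ((hcount.trans hsum).trans ?_) (by positivity : (0 : ℝ) < r + 1)
    calc _ ≤ ε * phi r * (#A).choose r * (#A - r) +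
          (#A).choose r * (ε * ((r + 1) * (#A - r))) := by gcongr
      _ ≤ (r + 1) * (ε * phi r * (#A).choose r * (#A - r)) +
          (#A).choose r * (ε * ((r + 1) * (#A - r))) := by
        have : 0 ≤ ε * phi r * (#A).choose r * (#A - r) :=
          mul_nonneg (by positivity) (by linarith)
        nlinarith
      _ = ε * phi (r + 1) * ((#A).choose r * (#A - r)) := by rw [phi_succ]; ring
      _ = _ := by rw [← hchoose]; ring

/-- Let `ε > 0`, `r ≥ 1` and `(A, B)` be an `ε`-uniform pair with density `d`.
Then at least `(1 − ε φ(r)) C(|A|, r)` `r`-sets `R ⊆ A` satisfy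
`d̂_B(R) − d^r |B| > −ε r |B|`. -/
theorem many_sets_codegree_lower {V : Type*} [DecidableEq V] (G : SimpleGraph V)
    [DecidableRel G.Adj] (ε : ℝ) (hε : 0 < ε) (r : ℕ) (hr : 1 ≤ r)
    (A B : Finset V) (hA : A.Nonempty) (hB : B.Nonempty) (hAB : Disjoint A B)
    (hunif : G.IsUniform ε A B) (d : ℝ) (hd : d = (G.edgeDensity A B : ℝ)) :
    (1 - ε * phi r) * ((#A).choose r : ℝ)
      ≤ (#((A.powersetCard r).filter fun R =>
          (codeg G B R : ℝ) - d ^ r * (#B : ℝ) > -(ε * r * (#B : ℝ))) : ℝ) := by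
  have hlow := card_filter_low_codeg_le hε hA hB hunif hd hr
  have hcompl := card_filter_add_card_filter_not (s := A.powersetCard r)
    fun R => (codeg G B R : ℝ) ≤ (d ^ r - ε * r) * #B
  rw [card_powersetCard, ← Nat.cast_inj (R := ℝ), Nat.cast_add] at hcompl
  have hgood : ((A.powersetCard r).filter fun R =>
      (codeg G B R : ℝ) - d ^ r * (#B : ℝ) > -(ε * r * (#B : ℝ))) =
      (A.powersetCard r).filter fun R => ¬ (codeg G B R : ℝ) ≤ (d ^ r - ε * r) * #B := by
    refine filter_congr fun R _ => ?_
    rw [not_le, gt_iff_lt, lt_sub_iff_add_lt]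
    ring_nf
  rw [hgood]
  linarith
end

section
/- Let ε > 0 and let (A₁, B) and (A₂, B) be ε-uniform pairs of disjoint vertex sets in a graph G, with densities d(A₁, B) = d₁ and d(A₂, B) = d₂, where A₁, A₂, B are pairwise disjoint. Then at least (1 − 2ε)·|A₁|·|A₂| of the pairs (u, v) ∈ A₁ × A₂ satisfy d̂_B({u, v}) − d₁·d₂·|B| > −2ε·|B|. -/
open SimpleGraph Finset

/-- In an `ε`-uniform pair `(A, B)`, fewer than `ε |A|` vertices of `A` have at most
`(d - ε) |Y|` neighbours in a given large subset `Y` of `B`. -/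
theorem SimpleGraph.IsUniform.card_low_degree_lt {V : Type*} [DecidableEq V] {G : SimpleGraph V}
    [DecidableRel G.Adj] {ε : ℝ} (hε : 0 < ε) {A B Y : Finset V} (hA : A.Nonempty)
    (hu : G.IsUniform ε A B) (hYB : Y ⊆ B) (hY : Y.Nonempty) (hYcard : (#B : ℝ) * ε ≤ #Y) :
    (#(A.filter fun a => (#(Y.filter fun y => G.Adj y a) : ℝ)
      ≤ ((G.edgeDensity A B : ℝ) - ε) * #Y) : ℝ) < #A * ε := by
  by_contra! h
  set X := A.filter fun a => (#(Y.filter fun y => G.Adj y a) : ℝ)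
      ≤ ((G.edgeDensity A B : ℝ) - ε) * #Y with hX
  have hApos : (0 : ℝ) < #A := by exact_mod_cast hA.card_pos
  have hXpos : (0 : ℝ) < #X := lt_of_lt_of_le (by positivity) h
  have hYpos : (0 : ℝ) < #Y := by exact_mod_cast hY.card_pos
  have hdens := (abs_lt.1 (hu (filter_subset _ _) hYB h hYcard)).1
  have hcount : (#(G.interedges X Y) : ℝ) = ∑ a ∈ X, (#(Y.filter fun y => G.Adj y a) : ℝ) := by
    have : #(G.interedges X Y) = ∑ a ∈ X, #(Y.filter fun y => G.Adj y a) := by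
      simp only [SimpleGraph.interedges, Rel.interedges, card_filter, sum_product, G.adj_comm]
    exact_mod_cast this
  have hsum : (#(G.interedges X Y) : ℝ) ≤ #X * (((G.edgeDensity A B : ℝ) - ε) * #Y) := by
    rw [hcount, ← nsmul_eq_mul]
    exact sum_le_card_nsmul _ _ _ fun a ha => (mem_filter.1 ha).2
  have hle : (G.edgeDensity X Y : ℝ) ≤ (G.edgeDensity A B : ℝ) - ε := by
    rw [SimpleGraph.edgeDensity_def]
    push_cast
    rw [div_le_iff₀ (by positivity)]
    linarith
  linarith

/-- If at least `a` elements `u` of `A` satisfy `P`, and each of them has at least `c` elements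
`v` of `C` with `Q (u, v)`, then at least `a * c` pairs of `A ×ˢ C` satisfy `Q`. -/
theorem Finset.mul_card_le_card_filter_product {α β : Type*} (A : Finset α) (C : Finset β)
    (P : α → Prop) [DecidablePred P] (Q : α × β → Prop) [DecidablePred Q] {a c : ℝ} (hc : 0 ≤ c)
    (hP : a ≤ #(A.filter P)) (hQ : ∀ u ∈ A, P u → c ≤ #(C.filter fun v => Q (u, v))) :
    a * c ≤ #((A ×ˢ C).filter Q) := by
  have hcount : (#((A ×ˢ C).filter Q) : ℝ) = ∑ u ∈ A, (#(C.filter fun v => Q (u, v)) : ℝ) := by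
    have : #((A ×ˢ C).filter Q) = ∑ u ∈ A, #(C.filter fun v => Q (u, v)) := by
      simp only [card_filter, sum_product]
    exact_mod_cast this
  calc a * c ≤ #(A.filter P) * c := by gcongr
    _ = ∑ _u ∈ A.filter P, c := by simp
    _ ≤ ∑ u ∈ A.filter P, (#(C.filter fun v => Q (u, v)) : ℝ) :=
        sum_le_sum fun u hu => hQ u (mem_filter.1 hu).1 (mem_filter.1 hu).2
    _ ≤ ∑ u ∈ A, (#(C.filter fun v => Q (u, v)) : ℝ) :=
        sum_le_sum_of_subset_of_nonneg (filter_subset _ _) fun _ _ _ => by positivity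
    _ = _ := hcount.symm

theorem codeg_pair {V : Type*} [DecidableEq V] (G : SimpleGraph V) [DecidableRel G.Adj]
    (B : Finset V) (u v : V) :
    codeg G B {u, v} = #((B.filter fun y => G.Adj y u).filter fun y => G.Adj y v) := by
  simp [codeg, filter_filter]

/-- Let `ε > 0` and `(A₁, B)`, `(A₂, B)` be `ε`-uniform pairs with densities `d₁, d₂`,
where `A₁, A₂, B` are pairwise disjoint. Then at least `(1 − 2ε)|A₁||A₂|` pairs
`(u, v) ∈ A₁ × A₂` satisfy `d̂_B({u,v}) − d₁ d₂ |B| > −2ε |B|`. -/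
theorem many_pairs_codegree_lower {V : Type*} [DecidableEq V] (G : SimpleGraph V)
    [DecidableRel G.Adj] (ε : ℝ) (hε : 0 < ε)
    (A₁ A₂ B : Finset V) (hA₁ : A₁.Nonempty) (hA₂ : A₂.Nonempty) (hB : B.Nonempty)
    (h₁₂ : Disjoint A₁ A₂) (h₁B : Disjoint A₁ B) (h₂B : Disjoint A₂ B)
    (hu₁ : G.IsUniform ε A₁ B) (hu₂ : G.IsUniform ε A₂ B)
    (d₁ d₂ : ℝ) (hd₁ : d₁ = (G.edgeDensity A₁ B : ℝ)) (hd₂ : d₂ = (G.edgeDensity A₂ B : ℝ)) :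
    (1 - 2 * ε) * (#A₁ : ℝ) * (#A₂ : ℝ)
      ≤ (#((A₁ ×ˢ A₂).filter fun p =>
          (codeg G B {p.1, p.2} : ℝ) - d₁ * d₂ * (#B : ℝ) > -(2 * ε * (#B : ℝ))) : ℝ) := by
  have hA₁pos : (0 : ℝ) < #A₁ := by exact_mod_cast hA₁.card_pos
  have hA₂pos : (0 : ℝ) < #A₂ := by exact_mod_cast hA₂.card_pos
  have hBpos : (0 : ℝ) < #B := by exact_mod_cast hB.card_pos
  have hAA : (0 : ℝ) < #A₁ * #A₂ := by positivity
  have hd₁0 : 0 ≤ d₁ := by rw [hd₁]; exact_mod_cast G.edgeDensity_nonneg A₁ B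
  have hd₂0 : 0 ≤ d₂ := by rw [hd₂]; exact_mod_cast G.edgeDensity_nonneg A₂ B
  have hd₁1 : d₁ ≤ 1 := by rw [hd₁]; exact_mod_cast G.edgeDensity_le_one A₁ B
  have hd₂1 : d₂ ≤ 1 := by rw [hd₂]; exact_mod_cast G.edgeDensity_le_one A₂ B
  rcases le_or_gt (1 / 2) ε with hbig | hsmall
  · refine le_trans ?_ (Nat.cast_nonneg _)
    nlinarith
  rcases lt_or_ge (d₁ * d₂) (2 * ε) with hlow | hhigh
  · rw [filter_true_of_mem, card_product]
    · push_cast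
      nlinarith
    · intro p _
      have : (0 : ℝ) ≤ codeg G B {p.1, p.2} := Nat.cast_nonneg _
      nlinarith
  have hd₁ε : 2 * ε ≤ d₁ := by nlinarith
  have hd₂ε : 2 * ε ≤ d₂ := by nlinarith
  have hgood₁ : (1 - ε) * #A₁ ≤ (#(A₁.filter fun u =>
      ¬ (#(B.filter fun y => G.Adj y u) : ℝ) ≤ (d₁ - ε) * #B) : ℝ) := by
    have hlt := hu₁.card_low_degree_lt hε hA₁ Subset.rfl hB (by nlinarith)
    rw [← hd₁] at hlt
    have hsplit : (#(A₁.filter fun u => (#(B.filter fun y => G.Adj y u) : ℝ) ≤ (d₁ - ε) * #B) : ℝ)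
        + #(A₁.filter fun u => ¬ (#(B.filter fun y => G.Adj y u) : ℝ) ≤ (d₁ - ε) * #B) = #A₁ := by
      exact_mod_cast card_filter_add_card_filter_not _
    linarith
  have hpairs := mul_card_le_card_filter_product A₁ A₂ _ (fun p =>
      (codeg G B {p.1, p.2} : ℝ) - d₁ * d₂ * (#B : ℝ) > -(2 * ε * (#B : ℝ)))
      (c := (1 - ε) * #A₂) (mul_nonneg (by linarith) hA₂pos.le) hgood₁ ?_
  · refine le_trans ?_ hpairs
    nlinarith [mul_nonneg (sq_nonneg ε) hAA.le]
  intro u _ hdeg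
  rw [not_le] at hdeg
  set Y := B.filter fun y => G.Adj y u with hY
  have hYε : (#B : ℝ) * ε ≤ #Y := by nlinarith
  have hYpos : (0 : ℝ) < #Y := lt_of_lt_of_le (by positivity) hYε
  have hlt := hu₂.card_low_degree_lt hε hA₂ (filter_subset _ _)
    (card_pos.1 (by exact_mod_cast hYpos)) hYε
  rw [← hd₂] at hlt
  have hsplit : (#(A₂.filter fun v => (#(Y.filter fun y => G.Adj y v) : ℝ) ≤ (d₂ - ε) * #Y) : ℝ)
      + #(A₂.filter fun v => ¬ (#(Y.filter fun y => G.Adj y v) : ℝ) ≤ (d₂ - ε) * #Y) = #A₂ := by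
    exact_mod_cast card_filter_add_card_filter_not _
  have hsub : (#(A₂.filter fun v => ¬ (#(Y.filter fun y => G.Adj y v) : ℝ) ≤ (d₂ - ε) * #Y) : ℝ)
      ≤ #(A₂.filter fun v =>
        (codeg G B {u, v} : ℝ) - d₁ * d₂ * (#B : ℝ) > -(2 * ε * (#B : ℝ))) := by
    norm_cast
    refine card_le_card (monotone_filter_right _ fun v _ hv => ?_)
    rw [not_le] at hv
    rw [codeg_pair]
    have hprod : (d₂ - ε) * ((d₁ - ε) * #B) ≤ (d₂ - ε) * #Y :=
      mul_le_mul_of_nonneg_left hdeg.le (by linarith)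
    have hdens : d₁ * d₂ - 2 * ε ≤ (d₂ - ε) * (d₁ - ε) := by nlinarith
    have := mul_le_mul_of_nonneg_right hdens hBpos.le
    linarith
  linarith
end
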